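/- Lower bound for FC: for every N ≥ 3, FC(N) ≥ log_3 binomial(N,2); equivalently, 3^(FC(N)) ≥ N(N−1)/2. -/

import Mathlib

/-- An adaptive strategy for balance weighings on `N` coins: a ternary decision
tree.  At a `weigh A B` node the sets `A` and `B` are placed on the two pans,
and the strategy branches on the outcome (`.lt`: left pan lighter, `.eq`:
balance, `.gt`: right pan lighter).  A leaf `output S` outputs the set `S` of
coins. -/
inductive FCTree (N : ℕ) : Type
  | output (S : Finset (Fin N)) : FCTree N
  | weigh (A B : Finset (Fin N)) (child : Ordering → FCTree N) : FCTree N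

namespace FCTree

/-- The depth (number of weighings in the worst case) of a strategy. -/
def depth {N : ℕ} : FCTree N → ℕ
  | output _ => 0
  | weigh _ _ child =>
      1 + max (depth (child .lt)) (max (depth (child .eq)) (depth (child .gt)))

/-- A strategy is well-formed if in every weighing the two pans are disjoint. -/
def WF {N : ℕ} : FCTree N → Prop
  | output _ => True
  | weigh A B child => Disjoint A B ∧ ∀ o, WF (child o)

end FCTree

/-- Weight of coin `x` when `f` is the fake coin, `c` is the chameleon, and the
chameleon chooses to weigh as a fake coin iff `b = true`.  Real coins weigh `1`
and the (lighter) fake coin weighs `0`. -/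
def coinWeight {N : ℕ} (f c : Fin N) (b : Bool) (x : Fin N) : ℕ :=
  if x = f then 0 else if x = c ∧ b = true then 0 else 1

/-- The outcome of weighing pan `A` against pan `B`, with fake `f`, chameleon
`c`, and chameleon choice `b`. -/
def weighOutcome {N : ℕ} (f c : Fin N) (b : Bool) (A B : Finset (Fin N)) : Ordering :=
  compare (∑ x ∈ A, coinWeight f c b x) (∑ x ∈ B, coinWeight f c b x)

/-- `Reaches f c t S` holds if, with fake coin `f` and chameleon `c`, some
sequence of choices by the chameleon (one choice before each weighing,
independently) leads the strategy `t` to output the set `S`. -/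
inductive Reaches {N : ℕ} (f c : Fin N) : FCTree N → Finset (Fin N) → Prop
  | output (S : Finset (Fin N)) : Reaches f c (.output S) S
  | weigh (A B : Finset (Fin N)) (child : Ordering → FCTree N) (b : Bool)
      (S : Finset (Fin N)) :
      Reaches f c (child (weighOutcome f c b A B)) S →
      Reaches f c (.weigh A B child) S

/-- `t` is an FC-solution for `N` coins in `w` weighings: a well-formed strategy
of depth at most `w` which, for every placement of the fake coin and the
chameleon and every sequence of choices by the chameleon, outputs a set of at
most 2 coins containing the fake coin. -/
def IsFCSolution {N : ℕ} (t : FCTree N) (w : ℕ) : Prop :=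
  t.WF ∧ t.depth ≤ w ∧
    ∀ f c : Fin N, f ≠ c → ∀ S, Reaches f c t S → S.card ≤ 2 ∧ f ∈ S

/-- There is an FC-algorithm in `w` weighings for `N` coins. -/
def FCAlgorithm (N w : ℕ) : Prop := ∃ t : FCTree N, IsFCSolution t w

/-- `FC N` is the least number of weighings `w` for which an FC-algorithm in
`w` weighings for `N` coins exists. -/
noncomputable def FC (N : ℕ) : ℕ := sInf {w | FCAlgorithm N w}

/-- Weight of coin `x` in the FF-problem with fake coins `f₁` and `f₂`. -/
def ffWeight {N : ℕ} (f₁ f₂ x : Fin N) : ℕ := if x = f₁ ∨ x = f₂ then 0 else 1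

/-- The (deterministic) run of a strategy in the FF-problem with fake coins
`f₁` and `f₂`; it returns the output set. -/
def ffRun {N : ℕ} (f₁ f₂ : Fin N) : FCTree N → Finset (Fin N)
  | .output S => S
  | .weigh A B child =>
      ffRun f₁ f₂
        (child (compare (∑ x ∈ A, ffWeight f₁ f₂ x) (∑ x ∈ B, ffWeight f₁ f₂ x)))

/-- There is an FF-algorithm in `w` weighings for `N` coins: a well-formed
strategy of depth at most `w` that identifies both fake coins for every
placement of the two fake coins. -/
def FFAlgorithm (N w : ℕ) : Prop :=
  ∃ t : FCTree N, t.WF ∧ t.depth ≤ w ∧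
    ∀ f₁ f₂ : Fin N, f₁ ≠ f₂ → ffRun f₁ f₂ t = {f₁, f₂}

/-- The group (of three coins) to which a coin of the scaled problem belongs. -/
def coinGroup {N : ℕ} (x : Fin (3 * N)) : Fin N :=
  ⟨x.val / 3, by have := x.isLt; omega⟩

/-- The set of coins of the scaled problem whose group lies in `A`. -/
def expandPan {N : ℕ} (A : Finset (Fin N)) : Finset (Fin (3 * N)) :=
  Finset.univ.filter (fun x => coinGroup x ∈ A)

/-- The scaling of a strategy, extended at the leaves: every coin is replaced
by a group of three coins, every weighing is performed on the corresponding
groups, and every leaf `output S` is replaced by the strategy `ext S`. -/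
def scaleExtend {N : ℕ} (ext : Finset (Fin N) → FCTree (3 * N)) :
    FCTree N → FCTree (3 * N)
  | .output S => ext S
  | .weigh A B child =>
      .weigh (expandPan A) (expandPan B) (fun o => scaleExtend ext (child o))

/-- A `(w,N)`-solution `t` is scalable if its scaling can be extended by (at
most) two further weighings at each leaf to a `(w+2, 3N)`-solution. -/
def IsScalable {N : ℕ} (t : FCTree N) (w : ℕ) : Prop :=
  ∃ ext : Finset (Fin N) → FCTree (3 * N),
    (∀ S, (ext S).WF ∧ (ext S).depth ≤ 2) ∧
    IsFCSolution (scaleExtend ext t) (w + 2)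

namespace FCTree

/-- The outputs occurring at the leaves of a strategy. -/
def outputs {N : ℕ} : FCTree N → Finset (Finset (Fin N))
  | output S => {S}
  | weigh _ _ child => outputs (child .lt) ∪ (outputs (child .eq) ∪ outputs (child .gt))

theorem card_outputs_le {N : ℕ} (t : FCTree N) : t.outputs.card ≤ 3 ^ t.depth := by
  induction t with
  | output S => simp [outputs, depth]
  | weigh A B child ih =>
    set m := max (child .lt).depth (max (child .eq).depth (child .gt).depth) with hm
    have key : ∀ o, (child o).outputs.card ≤ 3 ^ m := fun o =>
      (ih o).trans (Nat.pow_le_pow_right (by norm_num) (by cases o <;> omega))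
    have h₁ := Finset.card_union_le (child .lt).outputs
      ((child .eq).outputs ∪ (child .gt).outputs)
    have h₂ := Finset.card_union_le (child .eq).outputs (child .gt).outputs
    have hlt := key .lt
    have heq := key .eq
    have hgt := key .gt
    simp only [outputs, depth, ← hm, pow_add, pow_one]
    omega

/-- Weigh the listed pairs of coins against each other one by one, removing from the
candidate set `S` every coin that turns out to be the heavier one. -/
def eliminate {N : ℕ} : List (Fin N × Fin N) → Finset (Fin N) → FCTree N
  | [], S => output S
  | p :: l, S => weigh {p.1} {p.2} fun o =>
      eliminate l (match o with
        | .lt => S.erase p.2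
        | .eq => S
        | .gt => S.erase p.1)

theorem wf_eliminate {N : ℕ} (l : List (Fin N × Fin N)) (hl : ∀ p ∈ l, p.1 ≠ p.2)
    (S : Finset (Fin N)) : (eliminate l S).WF := by
  induction l generalizing S with
  | nil => trivial
  | cons p l ih =>
    exact ⟨by simpa using hl p (by simp), fun o => ih (fun q hq => hl q (by simp [hq])) _⟩

end FCTree

theorem ffRun_mem_outputs {N : ℕ} (f₁ f₂ : Fin N) (t : FCTree N) :
    ffRun f₁ f₂ t ∈ t.outputs := by
  induction t with
  | output S => simp [ffRun, FCTree.outputs]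
  | weigh A B child ih =>
    simp only [ffRun, FCTree.outputs, Finset.mem_union]
    generalize compare (∑ x ∈ A, ffWeight f₁ f₂ x) (∑ x ∈ B, ffWeight f₁ f₂ x) = o
    cases o <;> simp [ih]

theorem ffWeight_comm {N : ℕ} (f₁ f₂ : Fin N) : ffWeight f₁ f₂ = ffWeight f₂ f₁ := by
  ext x
  simp only [ffWeight, or_comm]

theorem ffRun_comm {N : ℕ} (f₁ f₂ : Fin N) (t : FCTree N) :
    ffRun f₁ f₂ t = ffRun f₂ f₁ t := by
  induction t with
  | output S => rfl
  | weigh A B child ih => simp only [ffRun, ih, ffWeight_comm f₁ f₂]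

theorem coinWeight_true {N : ℕ} (f c : Fin N) : coinWeight f c true = ffWeight f c := by
  ext x
  by_cases hf : x = f <;> simp [coinWeight, ffWeight, hf]

/-- A chameleon that always weighs as a fake coin turns the FC-problem into the FF-problem. -/
theorem reaches_ffRun {N : ℕ} (f c : Fin N) (t : FCTree N) : Reaches f c t (ffRun f c t) := by
  induction t with
  | output S => exact .output S
  | weigh A B child ih =>
    refine .weigh A B child true _ ?_
    simp only [weighOutcome, coinWeight_true, ffRun]
    exact ih _

theorem IsFCSolution.ffRun_eq {N w : ℕ} {t : FCTree N} (ht : IsFCSolution t w)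
    {f c : Fin N} (hfc : f ≠ c) : ffRun f c t = {f, c} := by
  obtain ⟨hcard, hf⟩ := ht.2.2 f c hfc _ (reaches_ffRun f c t)
  obtain ⟨-, hc⟩ := ht.2.2 c f hfc.symm _ (reaches_ffRun c f t)
  rw [ffRun_comm] at hc
  refine (Finset.eq_of_subset_of_card_le ?_ ?_).symm
  · simp [Finset.insert_subset_iff, hf, hc]
  · rwa [Finset.card_pair hfc]

theorem FCAlgorithm.choose_two_le {N w : ℕ} (h : FCAlgorithm N w) : N.choose 2 ≤ 3 ^ w := by
  obtain ⟨t, ht⟩ := h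
  have hsub : Finset.powersetCard 2 (Finset.univ : Finset (Fin N)) ⊆ t.outputs := by
    intro S hS
    obtain ⟨f, c, hfc, rfl⟩ := Finset.card_eq_two.mp (Finset.mem_powersetCard.mp hS).2
    exact ht.ffRun_eq hfc ▸ ffRun_mem_outputs f c t
  calc N.choose 2 = (Finset.powersetCard 2 (Finset.univ : Finset (Fin N))).card := by simp
    _ ≤ t.outputs.card := Finset.card_le_card hsub
    _ ≤ 3 ^ t.depth := t.card_outputs_le
    _ ≤ 3 ^ w := Nat.pow_le_pow_right (by norm_num) ht.2.1

theorem weighOutcome_singleton_right_ne_lt {N : ℕ} (f c : Fin N) (b : Bool) (x : Fin N) :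
    weighOutcome f c b {x} {f} ≠ .lt := by
  simp [weighOutcome, coinWeight, compare_lt_iff_lt]

theorem weighOutcome_singleton_left_ne_gt {N : ℕ} (f c : Fin N) (b : Bool) (x : Fin N) :
    weighOutcome f c b {f} {x} ≠ .gt := by
  simp [weighOutcome, coinWeight, compare_gt_iff_gt]

theorem weighOutcome_fake_real {N : ℕ} {f c x : Fin N} (b : Bool) (hf : x ≠ f) (hc : x ≠ c) :
    weighOutcome f c b {f} {x} = .lt := by
  simp [weighOutcome, coinWeight, hf, hc, compare_lt_iff_lt]

theorem Reaches.eliminate_spec {N : ℕ} {f c : Fin N} (l : List (Fin N × Fin N))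
    (hl : ∀ p ∈ l, p.1 ≠ p.2) (S T : Finset (Fin N)) (h : Reaches f c (.eliminate l S) T)
    (hfS : f ∈ S) :
    f ∈ T ∧ T ⊆ S ∧ ∀ x, x ≠ f → x ≠ c → (f, x) ∈ l → x ∉ T := by
  induction l generalizing S with
  | nil =>
    cases h
    simp [hfS]
  | cons p l ih =>
    obtain ⟨y, z⟩ := p
    cases h with
    | weigh _ _ _ b _ h =>
      have hlt : weighOutcome f c b {y} {z} = .lt → z ≠ f := by
        rintro h rfl
        exact weighOutcome_singleton_right_ne_lt _ _ _ _ h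
      have hgt : weighOutcome f c b {y} {z} = .gt → y ≠ f := by
        rintro h rfl
        exact weighOutcome_singleton_left_ne_gt _ _ _ _ h
      have hreal : y = f → z ≠ f → z ≠ c → weighOutcome f c b {y} {z} = .lt := by
        rintro rfl hf hc
        exact weighOutcome_fake_real b hf hc
      dsimp only at h
      generalize weighOutcome f c b {y} {z} = o at h hlt hgt hreal
      obtain ⟨hfT, hTS, hT⟩ := ih (fun q hq => hl q (by simp [hq])) _ h (by
        cases o <;> simp_all [eq_comm])
      refine ⟨hfT, hTS.trans ?_, fun x hxf hxc hx hxT => ?_⟩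
      · cases o <;> simp [Finset.erase_subset]
      · rcases List.mem_cons.mp hx with hx | hx
        · obtain ⟨rfl, rfl⟩ := Prod.mk.inj hx
          have := hreal rfl hxf hxc
          subst this
          simpa using hTS hxT
        · exact hT x hxf hxc hx hxT

theorem exists_fcAlgorithm (N : ℕ) : ∃ w, FCAlgorithm N w := by
  set l := (Finset.univ : Finset (Fin N)).offDiag.toList with hl
  have hne : ∀ p ∈ l, p.1 ≠ p.2 := by simp [hl]
  refine ⟨_, .eliminate l .univ, FCTree.wf_eliminate l hne _, le_rfl, fun f c _ T hT => ?_⟩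
  obtain ⟨hf, -, h⟩ := hT.eliminate_spec l hne _ _ (Finset.mem_univ f)
  refine ⟨(Finset.card_le_card (t := {f, c}) fun x hx => ?_).trans Finset.card_le_two, hf⟩
  by_contra hx'
  simp only [Finset.mem_insert, Finset.mem_singleton, not_or] at hx'
  exact h x hx'.1 hx'.2 (by simpa [hl] using Ne.symm hx'.1) hx

theorem fcAlgorithm_FC (N : ℕ) : FCAlgorithm N (FC N) := Nat.sInf_mem (exists_fcAlgorithm N)

/-- Lower bound for FC: for every N ≥ 3, FC(N) ≥ log₃ C(N,2); equivalently,
3^(FC(N)) ≥ N(N−1)/2. -/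
theorem fc_lower_bound (N : ℕ) (hN : 3 ≤ N) :
    Real.logb 3 (N.choose 2) ≤ (FC N : ℝ) ∧ N * (N - 1) / 2 ≤ 3 ^ FC N := by
  have h := (fcAlgorithm_FC N).choose_two_le
  refine ⟨?_, by rwa [← Nat.choose_two_right]⟩
  have hpos : 0 < N.choose 2 := Nat.choose_pos (by omega)
  rw [Real.logb_le_iff_le_rpow (by norm_num) (by exact_mod_cast hpos), Real.rpow_natCast]
  exact_mod_cast h
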